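/- arXiv:1303.6846 — 8 statements merged into one kernel-verified Lean document; each statement's English description precedes it below -/
import Mathlib

section
/- Let n be a nonempty finite index type and let A be an invertible n × n matrix over ℂ. Consider the linear map L on the space of n × n complex matrices defined by L(X) = A X A⁻¹. Then the spectrum of L equals the set {μ · ν⁻¹ : μ, ν ∈ spectrum(A)}. Consequently, the spectral radius of L equals the product of the spectral radius of A and the spectral radius of A⁻¹. -/
open scoped Pointwise in
lemma aux_inv {n : Type*} [Fintype n] [DecidableEq n]
    (A : Matrix n n ℂ) (hA : IsUnit A) : spectrum ℂ A⁻¹ = (spectrum ℂ A)⁻¹ := by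
  obtain ⟨u, rfl⟩ := hA
  rw [← Matrix.coe_units_inv, spectrum.map_inv]

lemma aux_ne {n : Type*} [Fintype n] [DecidableEq n]
    (A : Matrix n n ℂ) (hA : IsUnit A) {z : ℂ} (hz : z ∈ spectrum ℂ A) : z ≠ 0 := by
  rintro rfl
  exact (spectrum.zero_notMem_iff ℂ).2 hA hz

lemma aux_mem {n : Type*} [Fintype n] [DecidableEq n]
    (A : Matrix n n ℂ) {z : ℂ} :
    z ∈ spectrum ℂ A ↔ (algebraMap ℂ (Matrix n n ℂ) z - A).det = 0 := by
  rw [spectrum.mem_iff, Matrix.isUnit_iff_isUnit_det, isUnit_iff_ne_zero, not_not]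

lemma aux_intertwine {n : Type*} [Fintype n] [DecidableEq n]
    (A B X : Matrix n n ℂ) (h : A * X = X * B) (p : Polynomial ℂ) :
    Polynomial.aeval A p * X = X * Polynomial.aeval B p := by
  induction p using Polynomial.induction_on' with
  | add p q hp hq => simp [add_mul, mul_add, hp, hq]
  | monomial k a =>
    have hk : A ^ k * X = X * B ^ k := by
      have : SemiconjBy X B A := h.symm
      exact (this.pow_right k).symm
    simp only [Polynomial.aeval_monomial, Matrix.algebraMap_eq_diagonal, mul_assoc]
    rw [hk, ← mul_assoc, ← mul_assoc]
    congr 1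
    exact Algebra.commutes a X

open scoped Pointwise in
lemma aux_spec {n : Type*} [Fintype n] [DecidableEq n] [Nonempty n]
    (A : Matrix n n ℂ) (hA : IsUnit A) :
    spectrum ℂ (LinearMap.mulLeft ℂ A ∘ₗ LinearMap.mulRight ℂ A⁻¹ :
        Module.End ℂ (Matrix n n ℂ))
      = {z : ℂ | ∃ μ ∈ spectrum ℂ A, ∃ ν ∈ spectrum ℂ A, z = μ * ν⁻¹} := by
  have hd : IsUnit A.det := (Matrix.isUnit_iff_isUnit_det A).1 hA
  ext z
  rw [← Module.End.hasEigenvalue_iff_mem_spectrum, Set.mem_ofPred_eq]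
  constructor
  · intro h
    obtain ⟨X, hX⟩ := h.exists_hasEigenvector
    have hX0 := hX.2
    have hX1 : A * (X * A⁻¹) = z • X := by simpa using hX.apply_eq_smul
    have hX2 : A * X = X * (z • A) := by
      calc A * X = A * (X * A⁻¹) * A := by
            rw [mul_assoc, mul_assoc, Matrix.nonsing_inv_mul _ hd, mul_one]
        _ = _ := by rw [hX1]; simp
    have hz : z ≠ 0 := by
      rintro rfl
      apply hX0
      rw [zero_smul, mul_zero] at hX2
      exact hA.mul_right_eq_zero.1 hX2
    have h1 := aux_intertwine A (z • A) X hX2 A.charpoly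
    rw [Matrix.aeval_self_charpoly, zero_mul] at h1
    have h2 : (0 : ℂ) ∈ spectrum ℂ (Polynomial.aeval (z • A) A.charpoly) := by
      by_contra h3
      exact hX0 ((((spectrum.zero_notMem_iff ℂ).1 h3).mul_left_eq_zero).1 h1.symm)
    rw [spectrum.map_polynomial_aeval_of_nonempty _ _
      (spectrum.nonempty_of_isAlgClosed_of_finiteDimensional ℂ _)] at h2
    obtain ⟨w, hw, hw0⟩ := h2
    have hw1 : w ∈ spectrum ℂ A := Matrix.mem_spectrum_iff_isRoot_charpoly.2 hw0
    have hs : spectrum ℂ (z • A) = z • spectrum ℂ A :=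
      spectrum.unit_smul_eq_smul A (Units.mk0 z hz)
    rw [hs] at hw
    obtain ⟨ν, hν, rfl⟩ := hw
    refine ⟨_, hw1, ν, hν, ?_⟩
    have := aux_ne A hA hν
    simp [this]
  · rintro ⟨μ, hμ, ν, hν, rfl⟩
    have hν0 := aux_ne A hA hν
    obtain ⟨v, hv0, hv⟩ := Matrix.exists_mulVec_eq_zero_iff.2 ((aux_mem A).1 hμ)
    obtain ⟨w, hw0, hw⟩ := Matrix.exists_vecMul_eq_zero_iff.2 ((aux_mem A).1 hν)
    have hv1 : A.mulVec v = μ • v := by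
      rw [Matrix.sub_mulVec, sub_eq_zero, Algebra.algebraMap_eq_smul_one, Matrix.smul_mulVec,
        Matrix.one_mulVec] at hv
      exact hv.symm
    have hw1 : Matrix.vecMul w A = ν • w := by
      rw [Matrix.vecMul_sub, sub_eq_zero, Algebra.algebraMap_eq_smul_one, Matrix.vecMul_smul,
        Matrix.vecMul_one] at hw
      exact hw.symm
    have hw2 : Matrix.vecMul w A⁻¹ = ν⁻¹ • w := by
      have : ν • Matrix.vecMul w A⁻¹ = w := by
        rw [← Matrix.smul_vecMul, ← hw1, Matrix.vecMul_vecMul, Matrix.mul_nonsing_inv _ hd,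
          Matrix.vecMul_one]
      rw [← this, smul_smul, inv_mul_cancel₀ hν0, one_smul, this]
    refine Module.End.hasEigenvalue_of_hasEigenvector (x := Matrix.vecMulVec v w) ⟨?_, ?_⟩
    · rw [Module.End.mem_eigenspace_iff]
      simp only [LinearMap.comp_apply, LinearMap.mulLeft_apply, LinearMap.mulRight_apply]
      rw [Matrix.vecMulVec_mul, Matrix.mul_vecMulVec, hv1, hw2, Matrix.smul_vecMulVec,
        Matrix.vecMulVec_smul, smul_smul]
    · intro h
      obtain ⟨i, hi⟩ := Function.ne_iff.1 hv0
      obtain ⟨j, hj⟩ := Function.ne_iff.1 hw0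
      have := congrFun (congrFun h i) j
      simp [Matrix.vecMulVec_apply] at this
      exact this.elim hi hj

/-- Linear-algebraic content of the Lemma on the irreducible adjoint representation:
for an invertible complex matrix `A`, the conjugation operator `L : X ↦ A X A⁻¹`
on matrices has spectrum `{μ ν⁻¹ : μ, ν ∈ spectrum A}`, and consequently the
spectral radius of `L` is the product of the spectral radii of `A` and `A⁻¹`. -/
theorem stmt_3 {n : Type*} [Fintype n] [DecidableEq n] [Nonempty n]
    (A : Matrix n n ℂ) (hA : IsUnit A) :
    spectrum ℂ (LinearMap.mulLeft ℂ A ∘ₗ LinearMap.mulRight ℂ A⁻¹ :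
        Module.End ℂ (Matrix n n ℂ))
      = {z : ℂ | ∃ μ ∈ spectrum ℂ A, ∃ ν ∈ spectrum ℂ A, z = μ * ν⁻¹} ∧
    sSup ((fun z : ℂ => ‖z‖) ''
        spectrum ℂ (LinearMap.mulLeft ℂ A ∘ₗ LinearMap.mulRight ℂ A⁻¹ :
          Module.End ℂ (Matrix n n ℂ)))
      = sSup ((fun z : ℂ => ‖z‖) '' spectrum ℂ A) *
        sSup ((fun z : ℂ => ‖z‖) '' spectrum ℂ A⁻¹) := by
  refine ⟨aux_spec A hA, ?_⟩
  rw [aux_spec A hA, aux_inv A hA]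
  have hf : (spectrum ℂ A).Finite := by
    refine Set.Finite.subset A.charpoly.roots.toFinset.finite_toSet ?_
    intro z hz
    simp only [Finset.mem_coe, Multiset.mem_toFinset]
    exact (Polynomial.mem_roots A.charpoly_monic.ne_zero).2
      (Matrix.mem_spectrum_iff_isRoot_charpoly.1 hz)
  have hn : (spectrum ℂ A).Nonempty := spectrum.nonempty_of_isAlgClosed_of_finiteDimensional ℂ A
  obtain ⟨a, ha, ha'⟩ := Set.exists_max_image _ (fun z : ℂ => ‖z‖) hf hn
  obtain ⟨b, hb, hb'⟩ := Set.exists_max_image _ (fun z : ℂ => ‖z⁻¹‖) hf hn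
  have h1 : IsGreatest ((fun z : ℂ => ‖z‖) '' spectrum ℂ A) ‖a‖ := by
    refine ⟨⟨a, ha, rfl⟩, ?_⟩
    rintro _ ⟨z, hz, rfl⟩
    exact ha' z hz
  have h2 : IsGreatest ((fun z : ℂ => ‖z‖) '' (spectrum ℂ A)⁻¹) ‖b⁻¹‖ := by
    refine ⟨⟨b⁻¹, by simpa using hb, rfl⟩, ?_⟩
    rintro _ ⟨z, hz, rfl⟩
    simpa using hb' z⁻¹ hz
  have h3 : IsGreatest ((fun z : ℂ => ‖z‖) ''
      {z : ℂ | ∃ μ ∈ spectrum ℂ A, ∃ ν ∈ spectrum ℂ A, z = μ * ν⁻¹}) (‖a‖ * ‖b⁻¹‖) := by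
    refine ⟨⟨a * b⁻¹, ⟨a, ha, b, hb, rfl⟩, norm_mul _ _⟩, ?_⟩
    rintro _ ⟨_, ⟨μ, hμ, ν, hν, rfl⟩, rfl⟩
    change ‖μ * ν⁻¹‖ ≤ _
    rw [norm_mul]
    exact mul_le_mul (ha' μ hμ) (hb' ν hν) (norm_nonneg _) (norm_nonneg _)
  rw [h1.csSup_eq, h2.csSup_eq, h3.csSup_eq]
end

section
/- Let d ≥ 1 and let X be an infinite set. Let ξ : X → ℝ^d ∖ {0} and ξ* : X → (ℝ^d)* ∖ {0} be maps such that ξ*(x)(ξ(y)) = 0 if and only if x = y, and such that ξ(X) spans ℝ^d and ξ*(X) spans (ℝ^d)*. For x, y, z, t with x ≠ t and z ≠ y define b(x,y,z,t) = (ξ*(x)(ξ(y))/ξ*(z)(ξ(y))) · (ξ*(z)(ξ(t))/ξ*(x)(ξ(t))). For p ≥ 1 and tuples e_0, …, e_p, u_0, …, u_p in X with e_i ≠ u_0 for all i and e_0 ≠ u_j for all j, set χ^p(e,u) = det of the p × p matrix with (i,j)-entry b(e_i, u_j, e_0, u_0) for 1 ≤ i, j ≤ p. Then: (a) χ^{d+1}(e,u)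 = 0 for every such tuple with p = d + 1; and (b) there exists such a tuple with p = d for which χ^d(e,u) ≠ 0. -/
/-- The cross ratio of a convex map `(ξ, ξ*)` from a set `X` to `ℙ(ℝ^d)`:
`b(x,y,z,t) = (ξ*(x)(ξ(y))/ξ*(z)(ξ(y))) · (ξ*(z)(ξ(t))/ξ*(x)(ξ(t)))`. -/
noncomputable def crossRatioOf {X : Type*} {d : ℕ} (ξ : X → (Fin d → ℝ))
    (ξs : X → ((Fin d → ℝ) →ₗ[ℝ] ℝ)) (x y z t : X) : ℝ :=
  (ξs x (ξ y) / ξs z (ξ y)) * (ξs z (ξ t) / ξs x (ξ t))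

lemma aux_sum {X : Type*} {d n : ℕ} (ξ : X → (Fin d → ℝ))
    (ξs : X → ((Fin d → ℝ) →ₗ[ℝ] ℝ)) (x z t : X) (u : Fin n → X) (c : Fin n → ℝ) :
    ∑ j, crossRatioOf ξ ξs x (u j) z t * c j =
      (ξs z (ξ t) / ξs x (ξ t)) * ξs x (∑ j, (c j * (ξs z (ξ (u j)))⁻¹) • ξ (u j)) := by
  rw [map_sum, Finset.mul_sum]
  refine Finset.sum_congr rfl fun j _ => ?_
  simp only [crossRatioOf, map_smul, smul_eq_mul]
  ring

lemma aux_pick {X V : Type*} {d : ℕ} [AddCommGroup V] [Module ℝ V] [FiniteDimensional ℝ V]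
    (hV : Module.finrank ℝ V = d) (f : X → V) (h : Submodule.span ℝ (Set.range f) = ⊤) :
    ∃ e : Fin d → X, LinearIndependent ℝ (fun i => f (e i)) ∧
      Submodule.span ℝ (Set.range fun i => f (e i)) = ⊤ := by
  have key := Submodule.exists_fun_fin_finrank_span_eq ℝ (Set.range f)
  rw [h, finrank_top, hV] at key
  obtain ⟨g, hg, hs, hl⟩ := key
  choose e he using hg
  have : (fun i => f (e i)) = g := funext he
  exact ⟨e, this ▸ hl, this ▸ hs⟩

/-- Labourie's remark: the cross ratio of a convex map `(ξ, ξ*)` from an infinite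
set `X` to `ℙ(ℝ^d)` whose image spans has rank exactly `d`: all the determinants
`χ^{d+1}` vanish, while some determinant `χ^d` does not. -/
theorem stmt_6 {X : Type*} [Infinite X] (d : ℕ) (hd : 1 ≤ d)
    (ξ : X → (Fin d → ℝ)) (ξs : X → ((Fin d → ℝ) →ₗ[ℝ] ℝ))
    (hξ0 : ∀ x, ξ x ≠ 0) (hξs0 : ∀ x, ξs x ≠ 0)
    (hker : ∀ x y, ξs x (ξ y) = 0 ↔ x = y)
    (hspan : Submodule.span ℝ (Set.range ξ) = ⊤)
    (hspans : Submodule.span ℝ (Set.range ξs) = ⊤) :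
    (∀ e u : Fin (d + 2) → X, (∀ i, e i ≠ u 0) → (∀ j, e 0 ≠ u j) →
      Matrix.det (Matrix.of fun i j : Fin (d + 1) =>
        crossRatioOf ξ ξs (e i.succ) (u j.succ) (e 0) (u 0)) = 0) ∧
    (∃ e u : Fin (d + 1) → X, (∀ i, e i ≠ u 0) ∧ (∀ j, e 0 ≠ u j) ∧
      Matrix.det (Matrix.of fun i j : Fin d =>
        crossRatioOf ξ ξs (e i.succ) (u j.succ) (e 0) (u 0)) ≠ 0) := by
  constructor
  · intro e u he hu
    have hb : ∀ j, ξs (e 0) (ξ (u j)) ≠ 0 := fun j h => hu j ((hker _ _).1 h)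
    have hdep : ¬ LinearIndependent ℝ (fun j : Fin (d + 1) => ξ (u j.succ)) := by
      intro h
      have := h.fintype_card_le_finrank
      simp at this
    obtain ⟨g, hg, i, hi⟩ := Fintype.not_linearIndependent_iff.1 hdep
    rw [← Matrix.exists_mulVec_eq_zero_iff]
    refine ⟨fun j => g j * ξs (e 0) (ξ (u j.succ)), fun h => ?_, ?_⟩
    · have := congrFun h i
      simp [hi, hb] at this
    · funext k
      have h1 := aux_sum ξ ξs (e k.succ) (e 0) (u 0) (fun j : Fin (d + 1) => u j.succ)
        (fun j => g j * ξs (e 0) (ξ (u j.succ)))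
      simp only [mul_inv_cancel_right₀ (hb _), hg, map_zero, mul_zero] at h1
      exact h1
  · obtain ⟨u, hul, -⟩ := aux_pick (d := d) (by simp) ξ hspan
    obtain ⟨e, -, hes⟩ := aux_pick (d := d)
      (by simpa using Subspace.dual_finrank_eq (K := ℝ) (V := Fin d → ℝ)) ξs hspans
    obtain ⟨e0, he0⟩ := (Set.finite_range u).exists_notMem
    obtain ⟨u0, hu0⟩ := ((Set.finite_range e).insert e0).exists_notMem
    have hne : e0 ≠ u0 := fun h => hu0 (Or.inl h.symm)
    have hne1 : ∀ i, e i ≠ u0 := fun i h => hu0 (Or.inr ⟨i, h⟩)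
    have hne2 : ∀ j, e0 ≠ u j := fun j h => he0 ⟨j, h.symm⟩
    refine ⟨Fin.cons e0 e, Fin.cons u0 u, ?_, ?_, ?_⟩
    · intro i
      refine Fin.cases ?_ (fun i => ?_) i <;> simp [hne, hne1]
    · intro j
      refine Fin.cases ?_ (fun i => ?_) j <;> simp [hne, hne2]
    · simp only [Fin.cons_succ, Fin.cons_zero]
      intro hdet
      obtain ⟨c, hc, hM⟩ := Matrix.exists_mulVec_eq_zero_iff.2 hdet
      apply hc
      have hv : ∀ i, ξs (e i) (∑ j, (c j * (ξs e0 (ξ (u j)))⁻¹) • ξ (u j)) = 0 := by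
        intro i
        have h1 := aux_sum ξ ξs (e i) e0 u0 u c
        have h2 : ∑ j, crossRatioOf ξ ξs (e i) (u j) e0 u0 * c j = 0 := congrFun hM i
        rw [h2] at h1
        refine (mul_eq_zero.1 h1.symm).resolve_left (div_ne_zero ?_ ?_)
        · exact fun h => hne ((hker _ _).1 h)
        · exact fun h => hne1 i ((hker _ _).1 h)
      generalize hw : ∑ j, (c j * (ξs e0 (ξ (u j)))⁻¹) • ξ (u j) = w at hv
      have hall : ∀ φ : (Fin d → ℝ) →ₗ[ℝ] ℝ, φ w = 0 := by
        intro φ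
        have hφ : φ ∈ Submodule.span ℝ (Set.range fun i => ξs (e i)) := hes ▸ Submodule.mem_top
        induction hφ using Submodule.span_induction with
        | mem x hx => obtain ⟨i, rfl⟩ := hx; exact hv i
        | zero => rfl
        | add x y _ _ hx hy => simp [hx, hy]
        | smul a x _ hx => simp [hx]
      have hw0 : w = 0 := funext fun k => hall (LinearMap.proj k)
      rw [hw0] at hw
      funext j
      have := Fintype.linearIndependent_iff.1 hul _ hw j
      refine (mul_eq_zero.1 this).resolve_right (inv_ne_zero ?_)
      exact fun h => hne2 j ((hker _ _).1 h)
end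

section
/- Let X be a topological space such that for every pair of points x, y ∈ X the complement X ∖ {x, y} is nonempty and connected. Let b : X⁴ → ℝ be a cross ratio on X, i.e. b is continuous on X^{(4)} = {(x,y,z,t) : x ≠ t and y ≠ z} and satisfies, for all tuples in X^{(4)}: b(x,y,z,t) = b(z,t,x,y); b(x,y,x,t) = 1 and b(x,y,z,y) = 1; b(x,y,z,t) = 0 if and only if x = y or z = t; b(x,y,z,t) = b(x,y,z,w)·b(x,w,z,t) and b(x,y,z,t) = b(x,y,w,t)·b(w,y,z,t) whenever all tuples involved lie in X^{(4)}. Then b(x,y,z,t) ≥ 0 for every (x,y,z,t) ∈ X^{(4)}. -/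
/-- On a space in which the complement of every two-point set is nonempty and
connected, every cross ratio is nonnegative (the paper's observation used for
groups that do not split over a virtual ℤ). -/
theorem stmt_8 {X : Type*} [TopologicalSpace X]
    (hconn : ∀ x y : X, IsConnected ({x, y}ᶜ : Set X))
    (b : X → X → X → X → ℝ)
    (hcont : ContinuousOn (fun p : X × X × X × X => b p.1 p.2.1 p.2.2.1 p.2.2.2)
      {p : X × X × X × X | p.1 ≠ p.2.2.2 ∧ p.2.1 ≠ p.2.2.1})
    (hsymm : ∀ x y z t : X, x ≠ t → y ≠ z → b x y z t = b z t x y)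
    (hnorm1 : ∀ x y t : X, x ≠ t → y ≠ x → b x y x t = 1)
    (hnorm2 : ∀ x y z : X, x ≠ y → y ≠ z → b x y z y = 1)
    (hvanish : ∀ x y z t : X, x ≠ t → y ≠ z → (b x y z t = 0 ↔ x = y ∨ z = t))
    (hcoc1 : ∀ x y z t w : X, x ≠ t → y ≠ z → x ≠ w → w ≠ z →
      b x y z t = b x y z w * b x w z t)
    (hcoc2 : ∀ x y z t w : X, x ≠ t → y ≠ z → y ≠ w → w ≠ t →
      b x y z t = b x y w t * b w y z t) :
    ∀ x y z t : X, x ≠ t → y ≠ z → 0 ≤ b x y z t := by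
  intro x y z t hxt hyz
  by_contra hneg
  push Not at hneg
  have hne : ¬ (x = y ∨ z = t) := fun h => hneg.ne ((hvanish x y z t hxt hyz).2 h)
  push Not at hne
  obtain ⟨hxy, hzt⟩ := hne
  have hc : ContinuousOn (fun u => b x u z t) ({x, z}ᶜ : Set X) := by
    have hg : Continuous (fun u : X => ((x, u, z, t) : X × X × X × X)) := by fun_prop
    refine hcont.comp (f := fun u : X => ((x, u, z, t) : X × X × X × X)) hg.continuousOn ?_
    intro u hu
    simp only [Set.mem_compl_iff, Set.mem_insert_iff, Set.mem_singleton_iff, not_or] at hu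
    exact ⟨hxt, hu.2⟩
  have hy : y ∈ ({x, z}ᶜ : Set X) := by simp [hxy.symm, hyz]
  have ht : t ∈ ({x, z}ᶜ : Set X) := by simp [hxt.symm, hzt.symm]
  have h1 : b x t z t = 1 := hnorm2 x t z hxt hzt.symm
  obtain ⟨u, hu, hu0⟩ := (hconn x z).isPreconnected.intermediate_value hy ht hc
    (show (0 : ℝ) ∈ Set.Icc (b x y z t) (b x t z t) from ⟨hneg.le, by rw [h1]; norm_num⟩)
  simp only [Set.mem_compl_iff, Set.mem_insert_iff, Set.mem_singleton_iff, not_or] at hu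
  rcases (hvanish x u z t hxt hu.2).1 hu0 with h | h
  · exact hu.1 h.symm
  · exact hzt h
end

section
/- Let X be a compact topological space and φ : ℝ × X → X a continuous flow (φ(0,x) = x, φ(t+s, x) = φ(t, φ(s, x))). Let f, g : X → ℝ be continuous and strictly positive, and suppose there is a continuous function U : X → ℝ such that for every p ∈ X the map t ↦ U(φ(t, p)) is differentiable at 0 with derivative f(p) − g(p). For a strictly positive continuous h : X → ℝ, let κ_h(x, t) = ∫₀ᵗ h(φ(s, x)) ds and let α_h : X × ℝ → ℝ be the function determined by κ_h(x, α_h(x, t)) = t for all x, t. Then there exists a homeomorphism H : X → X such that H(φ(α_f(p, t), p)) = φ(α_g(H(p), t), H(p)) for all p ∈ X and t ∈ ℝ; that is, the reparametrization of φ by f is conjugate to the reparametrization of φ by g. -/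
section Aux
variable {X : Type*} [TopologicalSpace X]

lemma aux_cont (φ : ℝ → X → X) (hφcont : Continuous fun p : ℝ × X => φ p.1 p.2)
    (h : X → ℝ) (hc : Continuous h) (x : X) : Continuous fun s => h (φ s x) :=
  hc.comp (hφcont.comp (Continuous.prodMk continuous_id continuous_const))

lemma aux_mono (φ : ℝ → X → X) (hφcont : Continuous fun p : ℝ × X => φ p.1 p.2)
    (h : X → ℝ) (hc : Continuous h) (hpos : ∀ x, 0 < h x) (x : X) :
    StrictMono fun t : ℝ => ∫ s in (0:ℝ)..t, h (φ s x) := by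
  have c := aux_cont φ hφcont h hc x
  intro a b hab
  have h1 := intervalIntegral.integral_add_adjacent_intervals
    (c.intervalIntegrable (μ := MeasureTheory.volume) 0 a) (c.intervalIntegrable a b)
  have h2 : 0 < ∫ s in a..b, h (φ s x) :=
    intervalIntegral.intervalIntegral_pos_of_pos (c.intervalIntegrable a b) (fun s => hpos _) hab
  show (∫ s in (0:ℝ)..a, h (φ s x)) < ∫ s in (0:ℝ)..b, h (φ s x)
  linarith

lemma aux_add (φ : ℝ → X → X) (hφcont : Continuous fun p : ℝ × X => φ p.1 p.2)
    (hφadd : ∀ (t s : ℝ) (x : X), φ (t + s) x = φ t (φ s x))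
    (h : X → ℝ) (hc : Continuous h) (x : X) (r s : ℝ) :
    (∫ u in (0:ℝ)..(s + r), h (φ u x)) =
      (∫ u in (0:ℝ)..r, h (φ u x)) + ∫ u in (0:ℝ)..s, h (φ u (φ r x)) := by
  have c := aux_cont φ hφcont h hc x
  have h1 := intervalIntegral.integral_add_adjacent_intervals
    (c.intervalIntegrable (μ := MeasureTheory.volume) 0 r) (c.intervalIntegrable r (s + r))
  have h2 := intervalIntegral.integral_comp_add_right (a := 0) (b := s) (fun u => h (φ u x)) r
  simp only [zero_add, hφadd] at h2
  rw [h2, h1]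

lemma aux_alpha (φ : ℝ → X → X) (hφcont : Continuous fun p : ℝ × X => φ p.1 p.2)
    (h : X → ℝ) (hc : Continuous h) (hpos : ∀ x, 0 < h x) (α : X → ℝ → ℝ)
    (hα : ∀ (x : X) (t : ℝ), (∫ s in (0:ℝ)..(α x t), h (φ s x)) = t)
    (c : X → ℝ) (hcc : Continuous c) : Continuous fun x => α x (c x) := by
  have hk : ∀ a : ℝ, Continuous fun x => ∫ s in (0:ℝ)..a, h (φ s x) := by
    intro a
    apply intervalIntegral.continuous_parametric_intervalIntegral_of_continuous'
    exact hc.comp (hφcont.comp continuous_swap)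
  rw [continuous_iff_continuousAt]
  intro x
  have key := fun y => aux_mono φ hφcont h hc hpos y
  refine tendsto_order.2 ⟨fun a ha => ?_, fun b hb => ?_⟩
  · have h1 := key x ha
    simp only [hα] at h1
    filter_upwards [(hk a).continuousAt.eventually_lt hcc.continuousAt h1] with y hy
    refine (key y).lt_iff_lt.1 ?_
    simpa only [hα] using hy
  · have h1 := key x hb
    simp only [hα] at h1
    filter_upwards [hcc.continuousAt.eventually_lt (hk b).continuousAt h1] with y hy
    refine (key y).lt_iff_lt.1 ?_
    simpa only [hα] using hy

lemma aux_U (φ : ℝ → X → X) (hφcont : Continuous fun p : ℝ × X => φ p.1 p.2)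
    (hφ0 : ∀ x, φ 0 x = x) (hφadd : ∀ (t s : ℝ) (x : X), φ (t + s) x = φ t (φ s x))
    (f g : X → ℝ) (hfcont : Continuous f) (hgcont : Continuous g) (U : X → ℝ)
    (hU : ∀ p : X, HasDerivAt (fun t : ℝ => U (φ t p)) (f p - g p) 0) (x : X) (t : ℝ) :
    (∫ s in (0:ℝ)..t, f (φ s x)) - (∫ s in (0:ℝ)..t, g (φ s x)) = U (φ t x) - U x := by
  have cf := aux_cont φ hφcont f hfcont x
  have cg := aux_cont φ hφcont g hgcont x
  rw [← intervalIntegral.integral_sub (cf.intervalIntegrable _ _) (cg.intervalIntegrable _ _)]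
  have hd : ∀ r : ℝ, HasDerivAt (fun t : ℝ => U (φ t x)) (f (φ r x) - g (φ r x)) r := by
    intro r
    have h1 := hU (φ r x)
    rw [← sub_self r] at h1
    have h2 := HasDerivAt.comp_sub_const r r h1
    simpa only [← hφadd, sub_add_cancel] using h2
  rw [intervalIntegral.integral_eq_sub_of_hasDerivAt (fun r _ => hd r)
    ((cf.sub cg).intervalIntegrable _ _), hφ0]
end Aux

/-- Reparametrizations of a flow by Livšic-cohomologous positive functions are
conjugate: if `f − g` is the derivative along the flow of a continuous function `U`,
and `α_f`, `α_g` are the inverses of `t ↦ ∫₀ᵗ f(φ(s,x)) ds`, `t ↦ ∫₀ᵗ g(φ(s,x)) ds`,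
then there is a homeomorphism `H` conjugating the two reparametrized flows. -/
theorem stmt_14 {X : Type*} [TopologicalSpace X] [CompactSpace X]
    (φ : ℝ → X → X) (hφcont : Continuous fun p : ℝ × X => φ p.1 p.2)
    (hφ0 : ∀ x, φ 0 x = x) (hφadd : ∀ (t s : ℝ) (x : X), φ (t + s) x = φ t (φ s x))
    (f g : X → ℝ) (hfcont : Continuous f) (hgcont : Continuous g)
    (hfpos : ∀ x, 0 < f x) (hgpos : ∀ x, 0 < g x)
    (U : X → ℝ) (hUcont : Continuous U)
    (hU : ∀ p : X, HasDerivAt (fun t : ℝ => U (φ t p)) (f p - g p) 0)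
    (αf αg : X → ℝ → ℝ)
    (hαf : ∀ (x : X) (t : ℝ), (∫ s in (0:ℝ)..(αf x t), f (φ s x)) = t)
    (hαg : ∀ (x : X) (t : ℝ), (∫ s in (0:ℝ)..(αg x t), g (φ s x)) = t) :
    ∃ H : X ≃ₜ X, ∀ (p : X) (t : ℝ),
      H (φ (αf p t) p) = φ (αg (H p) t) (H p) := by
  have Ff := fun y => (aux_mono φ hφcont f hfcont hfpos y).injective
  have Gg := fun y => (aux_mono φ hφcont g hgcont hgpos y).injective
  have af := fun x r s => aux_add φ hφcont hφadd f hfcont x r s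
  have ag := fun x r s => aux_add φ hφcont hφadd g hgcont x r s
  have hUU := fun x t => aux_U φ hφcont hφ0 hφadd f g hfcont hgcont U hU x t
  refine ⟨{ toFun := fun p => φ (αg p (U p)) p
            invFun := fun q => φ (αf q (-U q)) q
            left_inv := ?_
            right_inv := ?_
            continuous_toFun := ?_
            continuous_invFun := ?_ }, ?_⟩
  · intro p
    show φ (αf (φ (αg p (U p)) p) (-U (φ (αg p (U p)) p))) (φ (αg p (U p)) p) = p
    have h0 := hαg p (U p)
    generalize αg p (U p) = r at *
    have h1 := hαf (φ r p) (-U (φ r p))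
    generalize αf (φ r p) (-U (φ r p)) = s at *
    rw [← hφadd]
    have h2 : s + r = 0 := by
      apply Ff p
      simp only [intervalIntegral.integral_same]
      linarith [af p r s, hUU p r]
    rw [h2, hφ0]
  · intro q
    show φ (αg (φ (αf q (-U q)) q) (U (φ (αf q (-U q)) q))) (φ (αf q (-U q)) q) = q
    have h0 := hαf q (-U q)
    generalize αf q (-U q) = r at *
    have h1 := hαg (φ r q) (U (φ r q))
    generalize αg (φ r q) (U (φ r q)) = s at *
    rw [← hφadd]
    have h2 : s + r = 0 := by
      apply Gg q
      simp only [intervalIntegral.integral_same]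
      linarith [ag q r s, hUU q r]
    rw [h2, hφ0]
  · exact hφcont.comp
      ((aux_alpha φ hφcont g hgcont hgpos αg hαg U hUcont).prodMk continuous_id)
  · exact hφcont.comp
      ((aux_alpha φ hφcont f hfcont hfpos αf hαf (fun q => -U q) hUcont.neg).prodMk continuous_id)
  · intro p t
    show φ (αg (φ (αf p t) p) (U (φ (αf p t) p))) (φ (αf p t) p)
      = φ (αg (φ (αg p (U p)) p) t) (φ (αg p (U p)) p)
    have h0 := hαf p t
    have h1 := hαg (φ (αf p t) p) (U (φ (αf p t) p))
    have h2 := hαg p (U p)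
    have h3 := hαg (φ (αg p (U p)) p) t
    rw [← hφadd, ← hφadd]
    congr 1
    apply Gg p
    show (∫ s in (0:ℝ).._, g (φ s p)) = ∫ s in (0:ℝ).._, g (φ s p)
    rw [ag, ag, h1, h2, h3]
    linarith [hUU p (αf p t)]
end

section
/- Let n ≥ 1, let W be an n-dimensional real vector space, and let φ_0, …, φ_n : W → ℝ be affine maps. Set Δ = {v ∈ W : φ_i(v) ≥ 0 for all i = 0, …, n}, and assume Δ is an n-dimensional simplex, i.e. Δ is the convex hull of n + 1 affinely independent points of W. Then there exists a unique v* ∈ Δ such that φ_0(v*) = φ_1(v*) = … = φ_n(v*), and for every v ∈ Δ one has min{φ_i(v) : i = 0, …, n} ≤ min{φ_i(v*) : i = 0, …, n}; that is, the maximum over Δ of the function v ↦ min_i φ_i(v) is attained exactly at the point where all the φ_i coincide. -/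
/-- The Linear Algebra Lemma of the paper (used in the proof of Theorem C): if
`n + 1` affine functionals on an `n`-dimensional real vector space cut out an
`n`-dimensional simplex `Δ = ⋂ {φᵢ ≥ 0}`, then there is a unique point of `Δ`
where all the `φᵢ` coincide, and the maximum over `Δ` of `v ↦ min_i φᵢ(v)` is
attained there. -/
theorem stmt_15 (n : ℕ) (hn : 1 ≤ n) {W : Type*} [AddCommGroup W] [Module ℝ W]
    [FiniteDimensional ℝ W] (hdim : Module.finrank ℝ W = n)
    (φ : Fin (n + 1) → (W →ᵃ[ℝ] ℝ))
    (hΔ : ∃ p : Fin (n + 1) → W, AffineIndependent ℝ p ∧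
      {v : W | ∀ i, 0 ≤ φ i v} = convexHull ℝ (Set.range p)) :
    ∃ vstar : W, (∀ i, 0 ≤ φ i vstar) ∧
      (∀ i j : Fin (n + 1), φ i vstar = φ j vstar) ∧
      (∀ v : W, (∀ i, 0 ≤ φ i v) → (∀ i j : Fin (n + 1), φ i v = φ j v) →
        v = vstar) ∧
      (∀ v : W, (∀ i, 0 ≤ φ i v) → (⨅ i, φ i v) ≤ ⨅ i, φ i vstar) := by
  obtain ⟨p, hp, hΔ⟩ := hΔ
  have htop : affineSpan ℝ (Set.range p) = ⊤ := by
    rw [hp.affineSpan_eq_top_iff_card_eq_finrank_add_one]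
    simp [hdim]
  let b : AffineBasis (Fin (n + 1)) ℝ W := ⟨p, hp, htop⟩
  have hbp : ∀ k, b k = p k := fun k => rfl
  have hΔ' : ∀ v : W, (∀ i, 0 ≤ φ i v) ↔ ∀ k, 0 ≤ b.coord k v := by
    intro v
    have h1 := b.convexHull_eq_nonneg_coord
    have h2 : (Set.range b) = Set.range p := rfl
    rw [h2, ← hΔ] at h1
    exact Set.ext_iff.mp h1 v
  have hf : ∀ (i : Fin (n + 1)) (v : W), φ i v = ∑ k, b.coord k v * φ i (b k) := by
    intro i v
    conv_lhs => rw [← b.affineCombination_coord_eq_self v]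
    rw [Finset.map_affineCombination _ _ _ (b.sum_coord_apply_eq_one v),
      Finset.affineCombination_eq_linear_combination _ _ _ (b.sum_coord_apply_eq_one v)]
    simp
  have hpt : ∀ w : Fin (n + 1) → ℝ, ∑ k, w k = 1 → ∃ v : W, ∀ k, b.coord k v = w k := by
    intro w hw
    exact ⟨Finset.univ.affineCombination ℝ b w, fun k =>
      b.coord_apply_combination_of_mem (Finset.mem_univ k) hw⟩
  have hpos : ∀ i k, 0 ≤ φ i (b k) := by
    intro i k
    refine (hΔ' (b k)).2 (fun j => ?_) i
    rw [b.coord_apply]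
    split_ifs <;> norm_num
  have hn' : (0 : ℝ) < n := by exact_mod_cast hn
  have key : ∀ j, ∃ i, 0 < φ i (b j) ∧ ∀ k, k ≠ j → φ i (b k) = 0 := by
    intro j
    by_contra hcon
    push Not at hcon
    have hev : ∀ᶠ ε : ℝ in nhdsWithin 0 (Set.Ioi 0), ∀ i,
        n * ε * φ i (b j) ≤ ∑ k ∈ Finset.univ.erase j, φ i (b k) := by
      rw [Filter.eventually_all]
      intro i
      rcases (hpos i j).eq_or_lt with h0 | h0
      · refine Filter.Eventually.of_forall fun ε => ?_
        rw [← h0, mul_zero]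
        exact Finset.sum_nonneg fun k _ => hpos i k
      · obtain ⟨k, hk, hk'⟩ := hcon i h0
        have hs : 0 < ∑ k ∈ Finset.univ.erase j, φ i (b k) :=
          Finset.sum_pos' (fun k _ => hpos i k)
            ⟨k, by simp [hk], lt_of_le_of_ne (hpos i k) (Ne.symm hk')⟩
        have hc : Filter.Tendsto (fun ε : ℝ => n * ε * φ i (b j)) (nhds 0) (nhds 0) := by
          have : Continuous (fun ε : ℝ => n * ε * φ i (b j)) := by fun_prop
          simpa using this.tendsto 0
        exact ((hc.eventually (gt_mem_nhds hs)).filter_mono nhdsWithin_le_nhds).mono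
          fun _ h => le_of_lt h
    obtain ⟨ε, hε, hε0⟩ := (hev.and self_mem_nhdsWithin).exists
    have hε0 : 0 < ε := hε0
    obtain ⟨v, hv⟩ := hpt (fun k => if k = j then -ε else (1 + ε) / n) (by
      rw [← Finset.add_sum_erase _ _ (Finset.mem_univ j),
        Finset.sum_congr rfl (g := fun _ => (1 + ε) / n)
          (fun k hk => if_neg (Finset.ne_of_mem_erase hk))]
      simp
      field_simp
      ring)
    have hin : ∀ i, 0 ≤ φ i v := by
      intro i
      rw [hf, ← Finset.add_sum_erase _ _ (Finset.mem_univ j),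
        Finset.sum_congr rfl (g := fun k => (1 + ε) / n * φ i (b k))
          (fun k hk => by rw [hv, if_neg (Finset.ne_of_mem_erase hk)]),
        ← Finset.mul_sum, hv, if_pos rfl]
      have h1 := hε i
      have h2 : 0 ≤ ∑ k ∈ Finset.univ.erase j, φ i (b k) :=
        Finset.sum_nonneg fun k _ => hpos i k
      have h3 : ε * φ i (b j) ≤ (∑ k ∈ Finset.univ.erase j, φ i (b k)) / n := by
        rw [le_div_iff₀ hn']; linarith
      have h4 : 0 ≤ (∑ k ∈ Finset.univ.erase j, φ i (b k)) / n := div_nonneg h2 hn'.le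
      have h5 : (1 + ε) / n * (∑ k ∈ Finset.univ.erase j, φ i (b k))
        = (1 + ε) * ((∑ k ∈ Finset.univ.erase j, φ i (b k)) / n) := by ring
      rw [h5]
      nlinarith [mul_nonneg hε0.le h4]
    have := (hΔ' v).1 hin j
    rw [hv, if_pos rfl] at this
    linarith
  choose τ hτ1 hτ2 using key
  have hinj : Function.Injective τ := by
    intro j k hjk
    by_contra hne
    have h1 := hτ2 j k (Ne.symm hne)
    have h2 := hτ1 k
    rw [← hjk] at h2
    linarith
  have hsurj : Function.Surjective τ := Finite.injective_iff_surjective.mp hinj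
  set c : Fin (n + 1) → ℝ := fun j => φ (τ j) (b j) with hc
  have hφ : ∀ j v, φ (τ j) v = b.coord j v * c j := by
    intro j v
    rw [hf, Finset.sum_eq_single j]
    · intro k _ hk
      rw [hτ2 j k hk, mul_zero]
    · simp
  have hcpos : ∀ j, 0 < c j := hτ1
  set S : ℝ := ∑ j, (c j)⁻¹ with hS
  have hSpos : 0 < S := Finset.sum_pos (fun j _ => inv_pos.2 (hcpos j)) Finset.univ_nonempty
  have hsum : ∀ v, ∑ j, φ (τ j) v * (c j)⁻¹ = 1 := by
    intro v
    rw [← b.sum_coord_apply_eq_one v]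
    refine Finset.sum_congr rfl fun j _ => ?_
    rw [hφ, mul_assoc, mul_inv_cancel₀ (hcpos j).ne', mul_one]
  obtain ⟨v, hv⟩ := hpt (fun j => (c j)⁻¹ / S) (by
    rw [← Finset.sum_div, div_self hSpos.ne'])
  have hval : ∀ i, φ i v = 1 / S := by
    intro i
    obtain ⟨j, rfl⟩ := hsurj i
    have := (hcpos j).ne'
    rw [hφ, hv]
    field_simp
  refine ⟨v, fun i => ?_, fun i j => by rw [hval, hval], fun u _ hu => ?_, fun u _ => ?_⟩
  · rw [hval]; positivity
  · have h1 : φ 0 u * S = 1 := by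
      rw [← hsum u, hS, Finset.mul_sum]
      exact Finset.sum_congr rfl fun j _ => by rw [hu 0 (τ j)]
    have h2 : ∀ j, b.coord j u = b.coord j v := by
      intro j
      apply mul_right_cancel₀ (hcpos j).ne'
      rw [← hφ, ← hφ, hval, hu (τ j) 0, eq_div_iff hSpos.ne', h1]
    rw [← b.affineCombination_coord_eq_self u, ← b.affineCombination_coord_eq_self v]
    congr 1
    exact funext h2
  · simp only [hval, ciInf_const]
    rw [le_div_iff₀ hSpos, ← hsum u, hS, Finset.mul_sum]
    refine Finset.sum_le_sum fun j _ => ?_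
    exact mul_le_mul_of_nonneg_right (ciInf_le (Set.finite_range _).bddBelow (τ j))
      (inv_pos.2 (hcpos j)).le
end

section
/- Let d ≥ 2 and let 𝔞⁺ = {a ∈ ℝ^d : a_1 + … + a_d = 0 and a_1 ≥ a_2 ≥ … ≥ a_d}. Let φ : ℝ^d → ℝ be a linear functional with φ(a) > 0 for every a ∈ 𝔞⁺ ∖ {0}, and let b ∈ ℝ^d be the barycenter direction given by b_i = d + 1 − 2i (so b = (d−1, d−3, …, 3−d, 1−d), which lies in 𝔞⁺). Then for every a ∈ 𝔞⁺ ∖ {0}: min{(a_i − a_{i+1})/φ(a) : 1 ≤ i ≤ d − 1} ≤ 2/φ(b); and for the barycenter itself, (b_i − b_{i+1})/φ(b) = 2/φ(b) for every i. -/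
/-- The barycenter direction of the Weyl chamber of `PGL(d,ℝ)`:
`b = (d−1, d−3, …, 3−d, 1−d)` (with `0`-based indexing, `b i = d − 1 − 2i`). -/
noncomputable def bary (d : ℕ) : Fin d → ℝ :=
  fun i => (d : ℝ) - 1 - 2 * ((i : ℕ) : ℝ)

theorem chain_aux (d : ℕ) (c : Fin d → ℝ)
    (h : ∀ (k : ℕ) (hk : k + 1 < d), c ⟨k + 1, hk⟩ ≤ c ⟨k, by omega⟩) :
    ∀ i j : Fin d, i ≤ j → c j ≤ c i := by
  have key : ∀ (i : Fin d) (n : ℕ) (hn : i.1 + n < d), c ⟨i.1 + n, hn⟩ ≤ c i := by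
    intro i n
    induction n with
    | zero => intro hn; exact le_refl _
    | succ n ih =>
      intro hn
      exact (h (i.1 + n) hn).trans (ih (by omega))
  intro i j hij
  have hij' : i.1 ≤ j.1 := hij
  have h1 := key i (j.1 - i.1) (by omega)
  have h2 : (⟨i.1 + (j.1 - i.1), by omega⟩ : Fin d) = j := Fin.ext (by simp; omega)
  rwa [h2] at h1

/-- The optimization in the proof of Theorem C for `PGL(d,ℝ)`: for a linear
functional `φ` positive on the Weyl chamber minus the origin, the minimum of the
normalized simple roots `(a_i − a_{i+1})/φ(a)` over the chamber is at most its
value `2/φ(b)` at the barycenter `b`, where all simple roots take the value `2`. -/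
theorem stmt_16 (d : ℕ) (hd : 2 ≤ d) (φ : (Fin d → ℝ) →ₗ[ℝ] ℝ)
    (hφ : ∀ a : Fin d → ℝ, (∑ i, a i = 0) → (∀ i j : Fin d, i ≤ j → a j ≤ a i) →
      a ≠ 0 → 0 < φ a) :
    (∑ i, bary d i = 0) ∧
    (∀ i j : Fin d, i ≤ j → bary d j ≤ bary d i) ∧
    (∀ a : Fin d → ℝ, (∑ i, a i = 0) → (∀ i j : Fin d, i ≤ j → a j ≤ a i) →
      a ≠ 0 →
      (⨅ i : Fin (d - 1),
          (a ⟨i.1, by have := i.2; omega⟩ - a ⟨i.1 + 1, by have := i.2; omega⟩)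
            / φ a)
        ≤ 2 / φ (bary d)) ∧
    (∀ i : Fin (d - 1),
      (bary d ⟨i.1, by have := i.2; omega⟩
          - bary d ⟨i.1 + 1, by have := i.2; omega⟩) / φ (bary d)
        = 2 / φ (bary d)) := by
  have hsum : ∑ i, bary d i = 0 := by
    have h : ∀ n : ℕ, ∀ x : ℝ,
        ∑ i ∈ Finset.range n, (x - 1 - 2 * (i : ℝ)) = n * (x - n) := by
      intro n x
      induction n with
      | zero => simp
      | succ n ih => rw [Finset.sum_range_succ, ih]; push_cast; ring
    unfold bary
    rw [Fin.sum_univ_eq_sum_range (fun i : ℕ => (d : ℝ) - 1 - 2 * (i : ℝ)) d, h]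
    ring
  have hmono : ∀ i j : Fin d, i ≤ j → bary d j ≤ bary d i := by
    intro i j hij
    have h : ((i : ℕ) : ℝ) ≤ ((j : ℕ) : ℝ) := by exact_mod_cast hij
    unfold bary
    linarith
  have hdr : (2 : ℝ) ≤ d := by exact_mod_cast hd
  have hne : bary d ≠ 0 := by
    intro h
    have h0 := congrFun h ⟨0, by omega⟩
    simp [bary] at h0
    linarith
  have hb := hφ _ hsum hmono hne
  refine ⟨hsum, hmono, ?_, ?_⟩
  · intro a ha hamono hane
    have hpa := hφ a ha hamono hane
    set m := ⨅ i : Fin (d - 1),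
          (a ⟨i.1, by have := i.2; omega⟩ - a ⟨i.1 + 1, by have := i.2; omega⟩)
            / φ a with hm
    have hle : ∀ (k : ℕ) (hk : k + 1 < d),
        m * φ a ≤ a ⟨k, by omega⟩ - a ⟨k + 1, hk⟩ := by
      intro k hk
      rw [← le_div_iff₀ hpa]
      exact ciInf_le (Set.finite_range _).bddBelow (⟨k, by omega⟩ : Fin (d - 1))
    have hc : 0 ≤ φ (a - (m * φ a / 2) • bary d) := by
      by_cases h0 : a - (m * φ a / 2) • bary d = 0
      · rw [h0, map_zero]
      · refine (hφ _ ?_ ?_ h0).le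
        · simp [Finset.sum_sub_distrib, ← Finset.mul_sum, ha, hsum]
        · apply chain_aux
          intro k hk
          have := hle k hk
          simp only [Pi.sub_apply, Pi.smul_apply, smul_eq_mul, bary]
          push_cast
          linarith
    rw [map_sub, map_smul, smul_eq_mul] at hc
    rw [le_div_iff₀ hb]
    by_contra hcon
    push Not at hcon
    nlinarith
  · intro i
    congr 1
    simp only [bary]
    push_cast
    ring
end

section
/- Let k ≥ 1 and, for each i ∈ {1, …, k}, let ε_i ∈ {−1, 1}, let α_i > 0 be a real number, and let P_i : ℝ → ℝ be a real exponential polynomial, P_i(t) = Σ_{j=1}^{m_i} c_{ij} · exp(r_{ij} t) with real coefficients c_{ij} and real exponents r_{ij}. Define F : ℝ → ℝ by F(t) = Σ_{i=1}^k ε_i · |P_i(t)|^{α_i}. Then either there exists T ∈ ℝ such that F(t) = 0 for all t ≥ T, or there exists T ∈ ℝ such that the set {t ≥ T : F(t) = 0} is finite. -/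
open Filter Topology

/-- eventually zero or eventually nonzero -/
def EZN (f : ℝ → ℝ) : Prop := (∀ᶠ t in atTop, f t = 0) ∨ (∀ᶠ t in atTop, f t ≠ 0)

lemma EZN.rolle {H D : ℝ → ℝ} (h : ∀ᶠ t in atTop, HasDerivAt H (D t) t) (hD : EZN D) : EZN H := by
  have key : ∃ T : ℝ, (∀ t ≥ T, HasDerivAt H (D t) t) ∧
      ((∀ t ≥ T, D t = 0) ∨ (∀ t ≥ T, D t ≠ 0)) := by
    rcases hD with hD | hD
    · obtain ⟨T, hT⟩ := eventually_atTop.1 (h.and hD)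
      exact ⟨T, fun t ht => (hT t ht).1, Or.inl fun t ht => (hT t ht).2⟩
    · obtain ⟨T, hT⟩ := eventually_atTop.1 (h.and hD)
      exact ⟨T, fun t ht => (hT t ht).1, Or.inr fun t ht => (hT t ht).2⟩
  obtain ⟨T, hT, hD⟩ := key
  by_cases hx : ∃ x ≥ T, H x = 0
  · obtain ⟨x, hxT, hx⟩ := hx
    have slope : ∀ y > x, ∃ c ≥ T, D c = (H y - H x) / (y - x) := by
      intro y hy
      obtain ⟨c, hc, h2⟩ := exists_hasDerivAt_eq_slope H D hy
        (fun z hz => (hT z (hxT.le.trans hz.1)).continuousAt.continuousWithinAt)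
        (fun z hz => hT z (hxT.le.trans hz.1.le))
      exact ⟨c, hxT.le.trans hc.1.le, h2⟩
    rcases hD with hD | hD
    · left
      filter_upwards [eventually_gt_atTop x] with y hy
      obtain ⟨c, hc, h2⟩ := slope y hy
      rw [hD c hc, hx, sub_zero, eq_comm, div_eq_zero_iff] at h2
      rcases h2 with h2 | h2
      · exact h2
      · linarith
    · right
      filter_upwards [eventually_gt_atTop x] with y hy h0
      obtain ⟨c, hc, h2⟩ := slope y hy
      apply hD c hc
      rw [h2, h0, hx]; simp
  · right
    push Not at hx
    filter_upwards [eventually_ge_atTop T] with y hy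
    exact hx y hy

lemma EZN.congr {f g : ℝ → ℝ} (hf : EZN f) (h : ∀ᶠ t in atTop, (g t = 0 ↔ f t = 0)) : EZN g := by
  rcases hf with hf | hf
  · left
    filter_upwards [hf, h] with t h1 h2 using h2.2 h1
  · right
    filter_upwards [hf, h] with t h1 h2 using fun h3 => h1 (h2.1 h3)

lemma EZN.main {ι : Type*} [DecidableEq ι] (A : Subalgebra ℝ (ℝ → ℝ))
    (hd : ∀ f ∈ A, ∃ g ∈ A, ∀ t, HasDerivAt f (g t) t)
    (hz : ∀ f ∈ A, EZN f) (u v q : ι → ℝ → ℝ) (p : ℝ → ℝ) (hp : p ∈ A)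
    (hp0 : ∀ᶠ t in atTop, p t ≠ 0) (hq : ∀ i, q i ∈ A)
    (hu0 : ∀ i, ∀ᶠ t in atTop, u i t ≠ 0)
    (hu : ∀ i, ∀ᶠ t in atTop, HasDerivAt (u i) (v i t) t)
    (huv : ∀ i, ∀ᶠ t in atTop, p t * v i t = q i t * u i t)
    (s : Finset ι) : ∀ Q : ι → ℝ → ℝ, (∀ i, Q i ∈ A) → EZN (fun t => ∑ i ∈ s, Q i t * u i t) := by
  induction s using Finset.induction_on with
  | empty => intro Q _; left; simp
  | insert a s ha ih =>
    intro Q hQ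
    rcases hz (Q a) (hQ a) with h0 | h0
    · refine (ih Q hQ).congr ?_
      filter_upwards [h0] with t ht
      rw [Finset.sum_insert ha, ht]; simp
    · choose Q' hQ' hQd using fun i => hd (Q i) (hQ i)
      have ihN := ih (fun i => (Q' i * p + Q i * q i) * Q a - Q i * (Q' a * p + Q a * q a))
        (fun i => A.sub_mem (A.mul_mem (A.add_mem (A.mul_mem (hQ' i) hp)
          (A.mul_mem (hQ i) (hq i))) (hQ a)) (A.mul_mem (hQ i) (A.add_mem (A.mul_mem (hQ' a) hp)
          (A.mul_mem (hQ a) (hq a)))))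
      have hu' := (Finset.eventually_all (insert a s)).2 fun i _ => hu i
      have huv' := (Finset.eventually_all (insert a s)).2 fun i _ => huv i
      have hH : EZN (fun t => (∑ i ∈ insert a s, Q i t * u i t) / (Q a t * u a t)) := by
        refine EZN.rolle (D := fun t => ((∑ i ∈ insert a s, (Q' i t * u i t + Q i t * v i t)) *
          (Q a t * u a t) - (∑ i ∈ insert a s, Q i t * u i t) *
            (Q' a t * u a t + Q a t * v a t)) / (Q a t * u a t) ^ 2) ?_ ?_
        · filter_upwards [h0, hu0 a, hu'] with t h1 h2 h3
          have e : ∀ i ∈ insert a s, HasDerivAt (fun t => Q i t * u i t)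
              (Q' i t * u i t + Q i t * v i t) t := fun i hi => (hQd i t).mul (h3 i hi)
          exact (HasDerivAt.fun_sum e).div (e a (Finset.mem_insert_self a s)) (mul_ne_zero h1 h2)
        · refine ihN.congr ?_
          filter_upwards [h0, hu0 a, huv', hp0] with t h1 h2 h3 h4
          have e : p t * ((∑ i ∈ insert a s, (Q' i t * u i t + Q i t * v i t)) *
            (Q a t * u a t) - (∑ i ∈ insert a s, Q i t * u i t) *
            (Q' a t * u a t + Q a t * v a t)) = u a t * ∑ i ∈ s,
            ((Q' i * p + Q i * q i) * Q a - Q i * (Q' a * p + Q a * q a)) t * u i t := by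
            have e0 : ∑ i ∈ s,
              ((Q' i * p + Q i * q i) * Q a - Q i * (Q' a * p + Q a * q a)) t * u i t
              = ∑ i ∈ insert a s,
              ((Q' i * p + Q i * q i) * Q a - Q i * (Q' a * p + Q a * q a)) t * u i t := by
              rw [Finset.sum_insert ha]
              simp only [Pi.sub_apply, Pi.mul_apply, Pi.add_apply]
              ring
            rw [e0, Finset.sum_mul, Finset.sum_mul, ← Finset.sum_sub_distrib, Finset.mul_sum,
              Finset.mul_sum]
            refine Finset.sum_congr rfl fun i hi => ?_
            simp only [Pi.sub_apply, Pi.mul_apply, Pi.add_apply]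
            have ei := h3 i hi
            have ea := h3 a (Finset.mem_insert_self a s)
            linear_combination Q i t * Q a t * u a t * ei - Q i t * u i t * Q a t * ea
          have e1 : (Q a t * u a t) ^ 2 ≠ 0 := pow_ne_zero _ (mul_ne_zero h1 h2)
          rw [div_eq_zero_iff, or_iff_left e1]
          refine (mul_eq_zero.trans (or_iff_right h4)).symm.trans ?_
          rw [e, mul_eq_zero, or_iff_right h2]
      refine hH.congr ?_
      filter_upwards [h0, hu0 a] with t h1 h2
      rw [div_eq_zero_iff, or_iff_left (mul_ne_zero h1 h2)]

/-- exponentials -/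
def expMon : Submonoid (ℝ → ℝ) where
  carrier := Set.range fun r : ℝ => fun t : ℝ => Real.exp (r * t)
  one_mem' := ⟨0, by ext; simp⟩
  mul_mem' := by
    rintro _ _ ⟨a, rfl⟩ ⟨b, rfl⟩
    exact ⟨a + b, by ext t; simp [add_mul, Real.exp_add]⟩

/-- exponential polynomials -/
def expPol : Subalgebra ℝ (ℝ → ℝ) := Algebra.adjoin ℝ (expMon : Set (ℝ → ℝ))

lemma mem_expPol {f : ℝ → ℝ} : f ∈ expPol ↔
    f ∈ Submodule.span ℝ (Set.range fun r : ℝ => fun t : ℝ => Real.exp (r * t)) := by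
  rw [← Subalgebra.mem_toSubmodule, expPol, Algebra.adjoin_eq_span, Submonoid.closure_eq]
  rfl

lemma exp_mem (r : ℝ) : (fun t : ℝ => Real.exp (r * t)) ∈ expPol :=
  Algebra.subset_adjoin ⟨r, rfl⟩

lemma hasDerivAt_exp_mul (r t : ℝ) :
    HasDerivAt (fun t : ℝ => Real.exp (r * t)) (r * Real.exp (r * t)) t := by
  have := ((hasDerivAt_id t).const_mul r).exp
  simpa [mul_comm] using this

lemma expPol_deriv : ∀ f ∈ expPol, ∃ g ∈ expPol, ∀ t, HasDerivAt f (g t) t := by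
  intro f hf
  rw [mem_expPol] at hf
  induction hf using Submodule.span_induction with
  | mem x h =>
    obtain ⟨r, rfl⟩ := h
    exact ⟨r • fun t : ℝ => Real.exp (r * t), expPol.smul_mem (exp_mem r) r,
      fun t => hasDerivAt_exp_mul r t⟩
  | zero => exact ⟨0, expPol.zero_mem, fun t => hasDerivAt_const t 0⟩
  | add x y _ _ hx hy =>
    obtain ⟨g, hg, h⟩ := hx
    obtain ⟨g', hg', h'⟩ := hy
    exact ⟨g + g', expPol.add_mem hg hg', fun t => (h t).add (h' t)⟩
  | smul a x _ hx =>
    obtain ⟨g, hg, h⟩ := hx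
    exact ⟨a • g, expPol.smul_mem hg a, fun t => (h t).const_smul a⟩

lemma expPol_EZN : ∀ f ∈ expPol, EZN f := by
  intro f hf
  rw [mem_expPol, Finsupp.mem_span_range_iff_exists_finsupp] at hf
  obtain ⟨c, rfl⟩ := hf
  have hconst : ∀ a : ℝ, (fun _ : ℝ => a) ∈ (⊥ : Subalgebra ℝ (ℝ → ℝ)) := fun a =>
    Algebra.mem_bot.2 ⟨a, rfl⟩
  have := EZN.main (⊥ : Subalgebra ℝ (ℝ → ℝ)) (by
      intro f hf
      obtain ⟨a, rfl⟩ := Algebra.mem_bot.1 hf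
      exact ⟨0, Subalgebra.zero_mem _, fun t => hasDerivAt_const t a⟩)
    (by
      intro f hf
      obtain ⟨a, rfl⟩ := Algebra.mem_bot.1 hf
      by_cases h : a = 0
      · left; simp [h]
      · right; simp [h])
    (fun r : ℝ => fun t : ℝ => Real.exp (r * t)) (fun r t => r * Real.exp (r * t))
    (fun r _ => r) 1 (Subalgebra.one_mem _) (by simp) (fun r => hconst r)
    (fun r => Eventually.of_forall fun t => (Real.exp_pos _).ne')
    (fun r => Eventually.of_forall fun t => hasDerivAt_exp_mul r t)
    (fun r => Eventually.of_forall fun t => by simp) c.support (fun r _ => c r)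
    (fun r => hconst _)
  refine this.congr (Eventually.of_forall fun t => ?_)
  simp [Finsupp.sum, Finset.sum_apply]

lemma hasDerivAt_abs_rpow_aux {P : ℝ → ℝ} {d t a : ℝ} (hP : HasDerivAt P d t) (h : P t ≠ 0) :
    HasDerivAt (fun t => |P t| ^ a) (a * d * |P t| ^ a / P t) t := by
  have h1 := (hP.log h).const_mul a |>.exp
  have e : (fun t => |P t| ^ a) =ᶠ[𝓝 t] fun t => Real.exp (a * Real.log (P t)) := by
    filter_upwards [hP.continuousAt.eventually_ne h] with x hx
    rw [Real.rpow_def_of_pos (abs_pos.2 hx), Real.log_abs, mul_comm]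
  refine (h1.congr_of_eventuallyEq e).congr_deriv ?_
  rw [e.eq_of_nhds]
  ring

/-- The Hardy-field Lemma: a function of the form `F(t) = Σᵢ εᵢ |Pᵢ(t)|^{αᵢ}`,
where each `Pᵢ` is a real exponential polynomial, either vanishes identically on
some half-line or has finitely many zeros on some half-line. -/
theorem stmt_17 (k : ℕ) (hk : 1 ≤ k) (ε : Fin k → ℝ)
    (hε : ∀ i, ε i = 1 ∨ ε i = -1) (α : Fin k → ℝ) (hα : ∀ i, 0 < α i)
    (m : Fin k → ℕ) (c r : (i : Fin k) → Fin (m i) → ℝ) :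
    (∃ T : ℝ, ∀ t : ℝ, T ≤ t →
      ∑ i, ε i * |∑ j, c i j * Real.exp (r i j * t)| ^ (α i) = 0) ∨
    (∃ T : ℝ, {t : ℝ | T ≤ t ∧
      ∑ i, ε i * |∑ j, c i j * Real.exp (r i j * t)| ^ (α i) = 0}.Finite) := by
  have hrep : ∀ i, ∃ P ∈ expPol, ∃ e : ℝ, (∀ᶠ t in atTop, P t ≠ 0) ∧ ∀ᶠ t in atTop,
      ε i * |∑ j, c i j * Real.exp (r i j * t)| ^ (α i) = e * |P t| ^ (α i) := by
    intro i
    have hm : (fun t => ∑ j, c i j * Real.exp (r i j * t)) ∈ expPol := by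
      have : (∑ j, c i j • fun t : ℝ => Real.exp (r i j * t)) ∈ expPol :=
        Subalgebra.sum_mem _ fun j _ => expPol.smul_mem (exp_mem _) _
      convert this using 1
      ext t
      simp [Finset.sum_apply]
    rcases expPol_EZN _ hm with h | h
    · refine ⟨1, expPol.one_mem, 0, by simp, ?_⟩
      filter_upwards [h] with t ht
      rw [ht]
      simp [(hα i).ne']
    · exact ⟨_, hm, ε i, h, Eventually.of_forall fun t => rfl⟩
  choose P hP e hP0 hPe using hrep
  choose P' hP' hPd using fun i => expPol_deriv (P i) (hP i)
  have hall := eventually_all.2 hP0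
  have key := EZN.main expPol expPol_deriv expPol_EZN (fun i t => |P i t| ^ (α i))
    (fun i t => α i * P' i t * |P i t| ^ (α i) / P i t)
    (fun i => (α i • P' i) * ∏ j ∈ Finset.univ.erase i, P j) (∏ j, P j)
    (Subalgebra.prod_mem _ fun j _ => hP j)
    (by
      filter_upwards [hall] with t ht
      rw [Finset.prod_apply]
      exact Finset.prod_ne_zero_iff.2 fun i _ => ht i)
    (fun i => expPol.mul_mem (expPol.smul_mem (hP' i) _) (Subalgebra.prod_mem _ fun j _ => hP j))
    (fun i => by
      filter_upwards [hP0 i] with t ht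
      exact (Real.rpow_pos_of_pos (abs_pos.2 ht) _).ne')
    (fun i => by
      filter_upwards [hP0 i] with t ht
      exact hasDerivAt_abs_rpow_aux (hPd i t) ht)
    (fun i => by
      filter_upwards [hP0 i] with t ht
      rw [← Finset.mul_prod_erase Finset.univ P (Finset.mem_univ i)]
      simp only [Pi.mul_apply, Pi.smul_apply, smul_eq_mul]
      field_simp)
    Finset.univ (fun i _ => e i) (fun i => expPol.algebraMap_mem (e i))
  have fin := key.congr (g := fun t => ∑ i, ε i * |∑ j, c i j * Real.exp (r i j * t)| ^ (α i)) (by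
    filter_upwards [eventually_all.2 hPe] with t ht
    rw [Finset.sum_congr rfl fun i _ => ht i])
  rcases fin with h | h
  · left
    exact eventually_atTop.1 h
  · right
    obtain ⟨T, hT⟩ := eventually_atTop.1 h
    refine ⟨T, ?_⟩
    convert Set.finite_empty (α := ℝ)
    ext t
    simp only [Set.mem_ofPred_eq, Set.mem_empty_iff_false, iff_false, not_and]
    exact fun h => hT t h
end

section
/- Let V be a nonzero finite-dimensional normed complex vector space and let g : V → V be a linear endomorphism. Since ℂ is algebraically closed, V decomposes as the direct sum of the generalized eigenspaces of g; for w ∈ V, write w = Σ_μ w_μ for the corresponding decomposition, where μ ranges over the eigenvalues of g. Then for every nonzero w ∈ V, the sequence ‖gⁿ(w)‖^{1/n} converges as n → ∞ to max{|μ| : μ an eigenvalue of g with w_μ ≠ 0}. -/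
open Filter Topology in
theorem aux_tendsto (a : ℕ → ℝ) (r c : ℝ) (hr : 0 ≤ r) (hc : 0 < c)
    (hlo : ∀ n, c * r ^ n ≤ a n)
    (hup : ∀ s, r < s → ∃ C, ∀ n, a n ≤ C * s ^ n) :
    Tendsto (fun n : ℕ => (a n) ^ (1 / (n : ℝ))) atTop (𝓝 r) := by
  have key : ∀ d t : ℝ, 0 < d →
      Tendsto (fun n : ℕ => d ^ (1 / (n : ℝ)) * t) atTop (𝓝 t) := by
    intro d t hd
    have h1 : Tendsto (fun n : ℕ => d ^ (1 / (n : ℝ))) atTop (𝓝 (d ^ (0 : ℝ))) :=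
      (Real.continuousAt_const_rpow hd.ne').tendsto.comp tendsto_one_div_atTop_nhds_zero_nat
    simpa using h1.mul_const t
  have key2 : ∀ d t : ℝ, 0 < d → 0 ≤ t → ∀ n : ℕ, n ≠ 0 →
      (d * t ^ n) ^ (1 / (n : ℝ)) = d ^ (1 / (n : ℝ)) * t := by
    intro d t hd ht n hn
    rw [Real.mul_rpow hd.le (pow_nonneg ht n), one_div, Real.pow_rpow_inv_natCast ht hn]
  have ha : ∀ n, 0 ≤ a n := fun n => le_trans (by positivity) (hlo n)
  rw [tendsto_order]
  constructor
  · intro b hb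
    filter_upwards [(tendsto_order.1 (key c r hc)).1 b hb, eventually_ne_atTop 0] with n h1 h2
    refine h1.trans_le ?_
    rw [← key2 c r hc hr n h2]
    exact Real.rpow_le_rpow (by positivity) (hlo n) (by positivity)
  · intro b hb
    obtain ⟨s, hs1, hs2⟩ := exists_between hb
    obtain ⟨C, hC⟩ := hup s hs1
    have hs : 0 ≤ s := hr.trans hs1.le
    have hD : 0 < max C 1 := lt_max_of_lt_right one_pos
    filter_upwards [(tendsto_order.1 (key (max C 1) s hD)).2 b hs2,
      eventually_ne_atTop 0] with n h1 h2
    refine lt_of_le_of_lt ?_ h1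
    rw [← key2 _ s hD hs n h2]
    refine Real.rpow_le_rpow (ha n) ((hC n).trans ?_) (by positivity)
    gcongr
    exact le_max_left _ _

theorem aux_upper {V : Type*} [NormedAddCommGroup V] [NormedSpace ℂ V]
    (g : V →ₗ[ℂ] V) (μ : ℂ) (s : ℝ) (hs : ‖μ‖ < s) (k : ℕ) :
    ∀ v : V, ((g - μ • (1 : Module.End ℂ V)) ^ k) v = 0 →
      ∃ C, ∀ n : ℕ, ‖(g ^ n) v‖ ≤ C * s ^ n := by
  have hs0 : 0 < s := (norm_nonneg μ).trans_lt hs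
  induction k with
  | zero =>
    intro v hv
    have : v = 0 := by simpa using hv
    exact ⟨0, fun n => by simp [this]⟩
  | succ k ih =>
    intro v hv
    rw [pow_succ, Module.End.mul_apply] at hv
    obtain ⟨C, hC⟩ := ih _ hv
    have hd : 0 < s - ‖μ‖ := sub_pos.2 hs
    refine ⟨max ‖v‖ (C / (s - ‖μ‖)), fun n => ?_⟩
    set D := max ‖v‖ (C / (s - ‖μ‖)) with hDdef
    induction n with
    | zero => simp [hDdef]
    | succ n ihn =>
      have e : (g ^ (n + 1)) v = μ • (g ^ n) v + (g ^ n) ((g - μ • (1 : Module.End ℂ V)) v) := by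
        rw [pow_succ, Module.End.mul_apply]
        simp
      have hDC : C ≤ D * (s - ‖μ‖) := by
        rw [← div_le_iff₀ hd]; exact le_max_right _ _
      have hp : 0 < s ^ n := by positivity
      calc ‖(g ^ (n + 1)) v‖ ≤ ‖μ‖ * ‖(g ^ n) v‖ + C * s ^ n := by
            rw [e]
            refine (norm_add_le _ _).trans ?_
            rw [norm_smul]
            exact add_le_add le_rfl (hC n)
        _ ≤ ‖μ‖ * (D * s ^ n) + (D * (s - ‖μ‖)) * s ^ n := by gcongr
        _ = D * s ^ (n + 1) := by ring

theorem aux_comm {V : Type*} [AddCommGroup V] [Module ℂ V] (g : V →ₗ[ℂ] V) (μ : ℂ) (k : ℕ) :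
    Commute g ((g - μ • (1 : Module.End ℂ V)) ^ k) := by
  apply Commute.pow_right
  apply Commute.sub_right (Commute.refl g)
  exact (Commute.one_right g).smul_right μ

theorem aux_kill {V : Type*} [AddCommGroup V] [Module ℂ V]
    (g : V →ₗ[ℂ] V) (wc : ℂ → V)
    (hmem : ∀ μ : ℂ, wc μ ∈ Module.End.maxGenEigenspace g μ) (μ0 : ℂ) (h0 : wc μ0 ≠ 0)
    (s : Finset ℂ) : μ0 ∉ s → ∃ L : Module.End ℂ V, Commute g L ∧ (∀ μ ∈ s, L (wc μ) = 0) ∧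
      L (wc μ0) ≠ 0 := by
  induction s using Finset.induction_on with
  | empty => exact fun _ => ⟨1, Commute.one_right g, by simp, by simpa using h0⟩
  | insert ν s hν ih =>
    intro hs
    rw [Finset.mem_insert, not_or] at hs
    obtain ⟨L, hL, hk, hne⟩ := ih hs.2
    obtain ⟨k, hk'⟩ := Module.End.mem_maxGenEigenspace g ν (wc ν) |>.1 (hmem ν)
    refine ⟨(g - ν • (1 : Module.End ℂ V)) ^ k * L, (aux_comm g ν k).mul_right hL, ?_, ?_⟩
    · intro μ hμ
      rcases Finset.mem_insert.1 hμ with rfl | hμ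
      · have hc : Commute ((g - μ • (1 : Module.End ℂ V)) ^ k) L := by
          apply Commute.pow_left
          apply Commute.sub_left hL
          exact (Commute.one_left L).smul_left μ
        rw [hc.eq, Module.End.mul_apply, hk', map_zero]
      · rw [Module.End.mul_apply, hk μ hμ, map_zero]
    · rw [Module.End.mul_apply]
      intro h
      have m1 : L (wc μ0) ∈ Module.End.maxGenEigenspace g ν :=
        (Module.End.mem_maxGenEigenspace g ν _).2 ⟨k, h⟩
      have m2 : L (wc μ0) ∈ Module.End.maxGenEigenspace g μ0 :=
        Module.End.mapsTo_maxGenEigenspace_of_comm hL μ0 (hmem μ0)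
      exact hne (Submodule.disjoint_def.1
        (Module.End.disjoint_genEigenspace g hs.1 _ _) _ m2 m1)

/-- Vector-level Gelfand formula (the analytic core of Benoist's Lemma): if `w ≠ 0`
decomposes as `w = Σ_μ w_μ` along the generalized eigenspaces of an endomorphism
`g` of a nonzero finite-dimensional normed complex vector space, then
`‖gⁿ(w)‖^{1/n}` converges to `max{|μ| : μ eigenvalue of g with w_μ ≠ 0}`. -/
theorem stmt_19 {V : Type*} [NormedAddCommGroup V] [NormedSpace ℂ V]
    [FiniteDimensional ℂ V] [Nontrivial V]
    (g : V →ₗ[ℂ] V) (w : V) (hw : w ≠ 0)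
    (wc : ℂ → V) (hsupp : (Function.support wc).Finite)
    (hmem : ∀ μ : ℂ, wc μ ∈ Module.End.maxGenEigenspace g μ)
    (hsum : w = ∑ᶠ μ, wc μ) :
    Filter.Tendsto (fun n : ℕ => ‖(g ^ n) w‖ ^ (1 / (n : ℝ))) Filter.atTop
      (nhds (sSup ((fun μ : ℂ => ‖μ‖) '' Function.support wc))) := by
  have hne : (Function.support wc).Nonempty := by
    rw [Function.support_nonempty_iff]
    rintro rfl
    exact hw (by simpa using hsum)
  have hfin := hsupp.image (fun μ : ℂ => ‖μ‖)
  obtain ⟨μ0, hμ0, hr⟩ := (hne.image (fun μ : ℂ => ‖μ‖)).csSup_mem hfin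
  have hle : ∀ μ ∈ Function.support wc, ‖μ‖ ≤ ‖μ0‖ := fun μ hμ => by
    have := le_csSup hfin.bddAbove (Set.mem_image_of_mem (fun μ : ℂ => ‖μ‖) hμ)
    rw [← hr] at this
    exact this
  rw [← hr]
  have hs : w = ∑ μ ∈ hsupp.toFinset, wc μ := by
    rw [hsum, finsum_eq_sum _ hsupp]
  -- an operator sending `w` to an eigenvector
  obtain ⟨L, hL, hk, hL0⟩ := aux_kill g wc hmem μ0 hμ0 (hsupp.toFinset.erase μ0) (by simp)
  have hLw : L w = L (wc μ0) := by
    rw [hs, map_sum]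
    refine Finset.sum_eq_single_of_mem μ0 (by simpa using hμ0) ?_
    intro b hb hb0
    exact hk b (Finset.mem_erase.2 ⟨hb0, hb⟩)
  have m2 : L (wc μ0) ∈ Module.End.maxGenEigenspace g μ0 :=
    Module.End.mapsTo_maxGenEigenspace_of_comm hL μ0 (hmem μ0)
  have hex := (Module.End.mem_maxGenEigenspace g μ0 _).1 m2
  classical
  obtain ⟨j, hj⟩ : ∃ j, Nat.find hex = j + 1 := Nat.exists_eq_succ_of_ne_zero fun h => by
    have := Nat.find_spec hex
    rw [h] at this
    exact hL0 (by simpa using this)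
  have hj1 : ((g - μ0 • (1 : Module.End ℂ V)) ^ j) (L (wc μ0)) ≠ 0 :=
    Nat.find_min hex (by omega)
  have hj2 : ((g - μ0 • (1 : Module.End ℂ V)) ^ (j + 1)) (L (wc μ0)) = 0 := by
    have := Nat.find_spec hex
    rwa [hj] at this
  set M : Module.End ℂ V := (g - μ0 • (1 : Module.End ℂ V)) ^ j * L with hM
  have hMc : Commute g M := (aux_comm g μ0 j).mul_right hL
  have hMw : M w ≠ 0 := by rw [hM, Module.End.mul_apply, hLw]; exact hj1
  have hgM : g (M w) = μ0 • M w := by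
    have h3 : (g - μ0 • (1 : Module.End ℂ V)) (M w) = 0 := by
      rw [hM, Module.End.mul_apply, hLw, ← Module.End.mul_apply, ← pow_succ']
      exact hj2
    rw [LinearMap.sub_apply, sub_eq_zero] at h3
    exact h3
  have hgn : ∀ n : ℕ, M ((g ^ n) w) = μ0 ^ n • M w := by
    intro n
    have : M ((g ^ n) w) = (g ^ n) (M w) := by
      rw [← Module.End.mul_apply, ← Module.End.mul_apply, (hMc.pow_left n).eq]
    rw [this]
    induction n with
    | zero => simp
    | succ n ih =>
      have h2 : M ((g ^ n) w) = (g ^ n) (M w) := by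
        rw [← Module.End.mul_apply, ← Module.End.mul_apply, (hMc.pow_left n).eq]
      rw [pow_succ, Module.End.mul_apply, hgM, map_smul, ih h2, smul_smul, pow_succ']
  have hbd : ∀ v, ‖M v‖ ≤ (‖LinearMap.toContinuousLinearMap M‖ + 1) * ‖v‖ := fun v => by
    have := (LinearMap.toContinuousLinearMap M).le_opNorm v
    simp only [LinearMap.coe_toContinuousLinearMap'] at this
    nlinarith [norm_nonneg v]
  have hK : 0 < ‖LinearMap.toContinuousLinearMap M‖ + 1 := by positivity
  refine aux_tendsto _ _ (‖M w‖ / (‖LinearMap.toContinuousLinearMap M‖ + 1)) (norm_nonneg _)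
    (div_pos (norm_pos_iff.2 hMw) hK) ?_ ?_
  · intro n
    have := hbd ((g ^ n) w)
    rw [hgn, norm_smul, norm_pow] at this
    rw [div_mul_eq_mul_div, div_le_iff₀ hK]
    linarith
  · intro s hs'
    have : ∀ μ, ∃ C, μ ∈ hsupp.toFinset → ∀ n : ℕ, ‖(g ^ n) (wc μ)‖ ≤ C * s ^ n := by
      intro μ
      by_cases h : μ ∈ hsupp.toFinset
      · obtain ⟨k, hk'⟩ := (Module.End.mem_maxGenEigenspace g μ _).1 (hmem μ)
        obtain ⟨C, hC⟩ := aux_upper g μ s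
          ((hle μ (hsupp.mem_toFinset.1 h)).trans_lt hs') k _ hk'
        exact ⟨C, fun _ => hC⟩
      · exact ⟨0, fun h' => absurd h' h⟩
    choose C hC using this
    refine ⟨∑ μ ∈ hsupp.toFinset, C μ, fun n => ?_⟩
    rw [hs, map_sum, Finset.sum_mul]
    exact (norm_sum_le _ _).trans (Finset.sum_le_sum fun μ hμ => hC μ hμ n)
end
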